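/- Consider the partial 4 × 4 grid G over ℂ⁴ with rows (e₃, ·, e₁, e₄), (·, e₄, e₃, e₂), (e₁, e₂, e₄, e₃), (e₄, e₃, e₂, e₁), with empty cells at positions (1,2) and (2,1). Among classical completions — fillings of the two empty cells by standard basis vectors of ℂ⁴ — the minimum SudoQ error is exactly √2: every classical completion has SudoQ error at least √2, and filling both empty cells with e₂ achieves error √2. In particular the classical Sudoku score satisfies 𝓔_c(G) = √2 > 1 = 𝓔_q(G), so the best quantum approximate solution of G is strictly better than every classical one. -/

import Mathlib

/-- The rank-one projection `|v⟩⟨v|` as a matrix. -/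
noncomputable def proj {κ : Type*} [Fintype κ] (v : EuclideanSpace ℂ κ) : Matrix κ κ ℂ :=
  fun i j => v i * star (v j)

/-- The Frobenius norm `‖A‖₂ = √(Tr(A* A))`. -/
noncomputable def frobNorm {κ : Type*} [Fintype κ] (A : Matrix κ κ ℂ) : ℝ :=
  Real.sqrt (Matrix.trace (A.conjTranspose * A)).re

/-- The standard basis of `ℂ⁴`. -/
noncomputable def E (k : Fin 4) : EuclideanSpace ℂ (Fin 4) :=
  EuclideanSpace.single k 1

/-- The partial grid `G` with rows `(e₃, ·, e₁, e₄)`, `(·, e₄, e₃, e₂)`,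
`(e₁, e₂, e₄, e₃)`, `(e₄, e₃, e₂, e₁)`, completed by placing the unit vector `x`
at position `(1,2)` and `y` at position `(2,1)` (1-indexed). -/
noncomputable def Gsq (x y : EuclideanSpace ℂ (Fin 4)) :
    Fin 4 → Fin 4 → EuclideanSpace ℂ (Fin 4) :=
  ![![E 2, x, E 0, E 3],
    ![y, E 3, E 2, E 1],
    ![E 0, E 1, E 3, E 2],
    ![E 3, E 2, E 1, E 0]]

/-- The twelve SudoQ constraints of a `4 × 4` grid: four rows, four columns, and
four `2 × 2` blocks, each given as the list of its four cells. -/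
def constraints : Fin 12 → Fin 4 → Fin 4 × Fin 4 :=
  ![fun j => (0, j), fun j => (1, j), fun j => (2, j), fun j => (3, j),
    fun i => (i, 0), fun i => (i, 1), fun i => (i, 2), fun i => (i, 3),
    ![(0, 0), (0, 1), (1, 0), (1, 1)], ![(0, 2), (0, 3), (1, 2), (1, 3)],
    ![(2, 0), (2, 1), (3, 0), (3, 1)], ![(2, 2), (2, 3), (3, 2), (3, 3)]]

/-- The deviation of the square `M` from constraint `c`:
`‖ Σ_{cells in c} |v⟩⟨v| − I₄ ‖₂`. -/
noncomputable def dev (M : Fin 4 → Fin 4 → EuclideanSpace ℂ (Fin 4)) (c : Fin 12) : ℝ :=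
  frobNorm ((∑ t : Fin 4, proj (M (constraints c t).1 (constraints c t).2)) - 1)

/-- The SudoQ error of a full square: the maximum deviation over the twelve
constraints. -/
noncomputable def sudoqError (M : Fin 4 → Fin 4 → EuclideanSpace ℂ (Fin 4)) : ℝ :=
  Finset.univ.sup' Finset.univ_nonempty (dev M)

/-- The Hilbert–Schmidt product of two rank-one projections. -/
lemma trace_proj_mul_proj {κ : Type*} [Fintype κ] (u v : EuclideanSpace ℂ κ) :
    (proj u * proj v).trace = ((‖inner ℂ u v‖ ^ 2 : ℝ) : ℂ) := by
  have h : (proj u * proj v).trace = inner ℂ u v * inner ℂ v u := by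
    simp only [Matrix.trace, Matrix.diag_apply, Matrix.mul_apply, proj, PiLp.inner_apply,
      RCLike.inner_apply, Finset.sum_mul_sum]
    rw [Finset.sum_comm]
    refine Finset.sum_congr rfl fun i _ => Finset.sum_congr rfl fun j _ => ?_
    simp only [RCLike.star_def]
    ring
  rw [h, ← inner_conj_symm v u, Complex.mul_conj, Complex.normSq_eq_norm_sq]

lemma proj_conjTranspose {κ : Type*} [Fintype κ] (v : EuclideanSpace ℂ κ) :
    (proj v).conjTranspose = proj v := by
  ext i j
  simp [proj, Matrix.conjTranspose_apply, mul_comm]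

lemma frobNorm_proj_sub_proj {κ : Type*} [Fintype κ] {u v : EuclideanSpace ℂ κ}
    (hu : ‖u‖ = 1) (hv : ‖v‖ = 1) :
    frobNorm (proj u - proj v) = Real.sqrt (2 - 2 * ‖inner ℂ u v‖ ^ 2) := by
  have hself {w : EuclideanSpace ℂ κ} (hw : ‖w‖ = 1) : ‖inner ℂ w w‖ = 1 := by
    rw [norm_inner_eq_norm_iff (𝕜 := ℂ) _ _ |>.2 ⟨1, one_ne_zero, (one_smul ℂ w).symm⟩]
      <;> simp [hw, ← norm_ne_zero_iff]
  rw [frobNorm, Matrix.conjTranspose_sub, proj_conjTranspose, proj_conjTranspose, sub_mul,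
    mul_sub, mul_sub]
  simp only [Matrix.trace_sub, trace_proj_mul_proj, Complex.sub_re, Complex.ofReal_re, hself hu,
    hself hv, norm_inner_symm v u]
  congr 1
  ring

lemma norm_E (k : Fin 4) : ‖E k‖ = 1 := by simp [E]

lemma frobNorm_proj_sub_proj_E {x : EuclideanSpace ℂ (Fin 4)} (hx : ‖x‖ = 1) (k : Fin 4) :
    frobNorm (proj x - proj (E k)) = Real.sqrt (2 - 2 * ‖x k‖ ^ 2) := by
  rw [frobNorm_proj_sub_proj hx (norm_E k)]
  simp [E, EuclideanSpace.inner_single_right]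

lemma one_eq_sum_proj_E :
    (1 : Matrix (Fin 4) (Fin 4) ℂ) = proj (E 0) + proj (E 1) + proj (E 2) + proj (E 3) := by
  ext i j
  fin_cases i <;> fin_cases j <;> simp [proj, E]

lemma frobNorm_zero {κ : Type*} [Fintype κ] : frobNorm (0 : Matrix κ κ ℂ) = 0 := by
  simp [frobNorm]

/-- The deviations of a completion of `G`; only the five constraints meeting an empty cell
can be violated. -/
lemma dev_Gsq (x y : EuclideanSpace ℂ (Fin 4)) :
    dev (Gsq x y) =
      ![frobNorm (proj x - proj (E 1)), frobNorm (proj y - proj (E 0)), 0, 0,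
        frobNorm (proj y - proj (E 1)), frobNorm (proj x - proj (E 0)), 0, 0,
        frobNorm (proj x + proj y - (proj (E 0) + proj (E 1))), 0, 0, 0] := by
  funext c
  rw [dev, one_eq_sum_proj_E, Fin.sum_univ_four]
  fin_cases c <;>
    first
    | exact congrArg frobNorm (by simp [constraints, Gsq]; abel)
    | refine (congrArg frobNorm ?_).trans frobNorm_zero
      simp [constraints, Gsq]
      try abel

lemma dev_le_sudoqError (M : Fin 4 → Fin 4 → EuclideanSpace ℂ (Fin 4)) (c : Fin 12) :
    dev M c ≤ sudoqError M :=
  Finset.le_sup' (dev M) (Finset.mem_univ c)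

lemma sudoqError_le {M : Fin 4 → Fin 4 → EuclideanSpace ℂ (Fin 4)} {r : ℝ}
    (h : ∀ c, dev M c ≤ r) : sudoqError M ≤ r :=
  Finset.sup'_le _ _ fun c _ => h c

lemma frobNorm_proj_E_sub_proj_E {k l : Fin 4} (h : k ≠ l) :
    frobNorm (proj (E k) - proj (E l)) = Real.sqrt 2 := by
  rw [frobNorm_proj_sub_proj_E (norm_E k)]
  simp [E, h.symm]

lemma sqrt_two_le_sudoqError (k l : Fin 4) :
    Real.sqrt 2 ≤ sudoqError (Gsq (E k) (E l)) := by
  by_cases h : k = 1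
  · refine le_trans ?_ (dev_le_sudoqError _ 5)
    have h0 : k ≠ 0 := by simp [h]
    simp [dev_Gsq, frobNorm_proj_E_sub_proj_E h0]
  · refine le_trans ?_ (dev_le_sudoqError _ 0)
    simp [dev_Gsq, frobNorm_proj_E_sub_proj_E h]

lemma sudoqError_Gsq_E_one : sudoqError (Gsq (E 1) (E 1)) = Real.sqrt 2 := by
  refine le_antisymm (sudoqError_le fun c => ?_) (sqrt_two_le_sudoqError 1 1)
  have h : frobNorm (proj (E 1) - proj (E 0)) = Real.sqrt 2 :=
    frobNorm_proj_E_sub_proj_E (by decide)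
  rw [dev_Gsq]
  fin_cases c <;> simp [frobNorm_zero, h]

lemma one_le_sudoqError_Gsq {x : EuclideanSpace ℂ (Fin 4)} (hx : ‖x‖ = 1)
    (y : EuclideanSpace ℂ (Fin 4)) : 1 ≤ sudoqError (Gsq x y) := by
  have hsum : ‖x 0‖ ^ 2 + ‖x 1‖ ^ 2 ≤ 1 := by
    have h := EuclideanSpace.norm_sq_eq x
    rw [hx, Fin.sum_univ_four] at h
    nlinarith [sq_nonneg ‖x 2‖, sq_nonneg ‖x 3‖]
  rcases le_total (‖x 0‖ ^ 2) (1 / 2) with h | h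
  · refine le_trans ?_ (dev_le_sudoqError _ 5)
    simp only [dev_Gsq]
    change 1 ≤ frobNorm (proj x - proj (E 0))
    rw [frobNorm_proj_sub_proj_E hx, Real.one_le_sqrt]
    linarith
  · refine le_trans ?_ (dev_le_sudoqError _ 0)
    simp only [dev_Gsq]
    change 1 ≤ frobNorm (proj x - proj (E 1))
    rw [frobNorm_proj_sub_proj_E hx, Real.one_le_sqrt]
    linarith

/-- The balanced superpositions of `e₁` and `e₂` form a completion of error `1`. -/
lemma exists_sudoqError_Gsq_eq_one : ∃ x y : EuclideanSpace ℂ (Fin 4),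
    ‖x‖ = 1 ∧ ‖y‖ = 1 ∧ 1 = sudoqError (Gsq x y) := by
  obtain ⟨s, hs⟩ : ∃ s : ℝ, s ^ 2 = 1 / 2 := ⟨√(1 / 2), Real.sq_sqrt (by norm_num)⟩
  have hsC : (s : ℂ) * s = 1 / 2 := by
    rw [← sq, ← Complex.ofReal_pow, hs]
    norm_num
  let x : EuclideanSpace ℂ (Fin 4) := !₂[(s : ℂ), s, 0, 0]
  let y : EuclideanSpace ℂ (Fin 4) := !₂[(s : ℂ), -s, 0, 0]
  have hx : ‖x‖ = 1 := by
    rw [EuclideanSpace.norm_eq, Real.sqrt_eq_one]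
    simp [x, Fin.sum_univ_four, hs]
    norm_num
  have hy : ‖y‖ = 1 := by
    rw [EuclideanSpace.norm_eq, Real.sqrt_eq_one]
    simp [y, Fin.sum_univ_four, hs]
    norm_num
  have hxy : proj x + proj y = proj (E 0) + proj (E 1) := by
    ext i j
    fin_cases i <;> fin_cases j <;> simp [proj, E, x, y, hsC] <;> norm_num
  refine ⟨x, y, hx, hy, le_antisymm (one_le_sudoqError_Gsq hx y) (sudoqError_le fun c => ?_)⟩
  rw [dev_Gsq, hxy, sub_self]
  fin_cases c <;>
    simp [frobNorm_zero, frobNorm_proj_sub_proj_E hx, frobNorm_proj_sub_proj_E hy, x, y, hs] <;>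
    norm_num

/-- Among classical completions of `G` (filling the two empty cells by standard
basis vectors), the minimum SudoQ error is exactly `√2`: every classical completion
has error at least `√2`, and filling both empty cells with `e₂` achieves `√2`. In
particular `𝓔_c(G) = √2 > 1 = 𝓔_q(G)`: the best quantum approximate solution of `G`
is strictly better than every classical one. -/
theorem classical_score_sqrt_two_gt_quantum_score_one :
    (∀ k l : Fin 4, Real.sqrt 2 ≤ sudoqError (Gsq (E k) (E l))) ∧
    sudoqError (Gsq (E 1) (E 1)) = Real.sqrt 2 ∧
    sInf {r : ℝ | ∃ k l : Fin 4, r = sudoqError (Gsq (E k) (E l))} = Real.sqrt 2 ∧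
    sInf {r : ℝ | ∃ x y : EuclideanSpace ℂ (Fin 4),
      ‖x‖ = 1 ∧ ‖y‖ = 1 ∧ r = sudoqError (Gsq x y)} = 1 ∧
    (1 : ℝ) < Real.sqrt 2 := by
  refine ⟨sqrt_two_le_sudoqError, sudoqError_Gsq_E_one, IsLeast.csInf_eq ⟨?_, ?_⟩,
    IsLeast.csInf_eq ⟨exists_sudoqError_Gsq_eq_one, ?_⟩, Real.one_lt_sqrt_two⟩
  · exact ⟨1, 1, sudoqError_Gsq_E_one.symm⟩
  · rintro _ ⟨k, l, rfl⟩
    exact sqrt_two_le_sudoqError k l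
  · rintro _ ⟨x, y, hx, -, rfl⟩
    exact one_le_sudoqError_Gsq hx y
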